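/- For every d ≥ 1 and every x ∈ ℝ^d, ψ_d(x) = ReLU(1 - d + Σ_{j=1}^d (ReLU(x_j + 1) - 2·ReLU(x_j))), where ψ_d(x) = max(0, 1 - Σ_{j=1}^d |x_j|). -/

import Mathlib

theorem stmt_5 (d : ℕ) (hd : 1 ≤ d) (x : Fin d → ℝ) :
    max 0 (1 - ∑ j, |x j|) =
      max 0 (1 - (d : ℝ) + ∑ j, (max 0 (x j + 1) - 2 * max 0 (x j))) := by
  have key : 1 - (d : ℝ) + ∑ j, (max 0 (x j + 1) - 2 * max 0 (x j))
      = 1 - ∑ j, (1 - (max 0 (x j + 1) - 2 * max 0 (x j))) := by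
    rw [Finset.sum_sub_distrib (fun _ => (1 : ℝ))]
    simp
    ring
  rw [key]
  by_cases h : ∀ j, -1 ≤ x j
  · congr 2
    refine Finset.sum_congr rfl fun j _ => ?_
    have hj := h j
    rw [max_eq_right (by linarith : (0 : ℝ) ≤ x j + 1)]
    rcases le_total 0 (x j) with h0 | h0
    · rw [max_eq_right h0, abs_of_nonneg h0]; ring
    · rw [max_eq_left h0, abs_of_nonpos h0]; ring
  · push Not at h
    obtain ⟨j, hj⟩ := h
    have h1 : |x j| ≤ ∑ j, |x j| :=
      Finset.single_le_sum (f := fun j => |x j|) (fun i _ => abs_nonneg _) (Finset.mem_univ j)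
    have h2 : 1 - (max 0 (x j + 1) - 2 * max 0 (x j))
        ≤ ∑ j, (1 - (max 0 (x j + 1) - 2 * max 0 (x j))) := by
      refine Finset.single_le_sum (f := fun j => 1 - (max 0 (x j + 1) - 2 * max 0 (x j)))
        (fun i _ => ?_) (Finset.mem_univ j)
      have a := le_max_left 0 (x i)
      have b := le_max_right 0 (x i)
      have c : max 0 (x i + 1) ≤ 1 + 2 * max 0 (x i) := max_le (by linarith) (by linarith)
      show 0 ≤ 1 - (max 0 (x i + 1) - 2 * max 0 (x i))
      linarith
    rw [max_eq_left (by linarith : x j + 1 ≤ 0), max_eq_left (by linarith : x j ≤ 0)] at h2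
    rw [abs_of_neg (by linarith)] at h1
    rw [max_eq_left (by linarith), max_eq_left (by linarith)]
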